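/- Let d be a real number with 0 < d < 1/2. Then the iterated integral ∫₀¹∫₀^{y₁}∫₀^{y₂}∫₀^{y₃}∫₀^{y₄} (y₁−y₃)^(−d)(y₂−y₃)^(−d)(y₂−y₄)^(−d)(y₁−y₅)^(−d)(y₄−y₅)^(−d) dy₅ dy₄ dy₃ dy₂ dy₁ equals Γ(1−d)³·(Γ(4−5d)/(Γ(4−4d)·Γ(6−5d)))·(Γ(2−2d)·Γ(2d−1)/Γ(d)) − (Γ(1−d)/(1−d))·(Γ(2d−1)/Γ(2d))·(Γ(3−3d)·Γ(4−5d)/(Γ(4−4d)·Γ(6−5d)))·₃F₂(1, d, 2d−1; 2−d, 2d; 1). -/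

import Mathlib

open Real

noncomputable def poch (a : ℝ) (k : ℕ) : ℝ := ∏ i ∈ Finset.range k, (a + i)

noncomputable def F21 (a b c x : ℝ) : ℝ :=
  ∑' k : ℕ, poch a k * poch b k / (poch c k * (Nat.factorial k : ℝ)) * x ^ k

noncomputable def F32 (a b c e f : ℝ) : ℝ :=
  ∑' k : ℕ, poch a k * poch b k * poch c k / (poch e k * poch f k * (Nat.factorial k : ℝ))

noncomputable def F32x (a b c e f x : ℝ) : ℝ :=
  ∑' k : ℕ, poch a k * poch b k * poch c k / (poch e k * poch f k * (Nat.factorial k : ℝ)) * x ^ k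

noncomputable def F43 (a b c g e f h : ℝ) : ℝ :=
  ∑' k : ℕ, poch a k * poch b k * poch c k * poch g k /
    (poch e k * poch f k * poch h k * (Nat.factorial k : ℝ))

open MeasureTheory ProbabilityTheory Set Filter Topology
open scoped ENNReal

/-- power kernel -/
noncomputable def PK (a x : ℝ) : ℝ≥0∞ := if 0 < x then ENNReal.ofReal (x ^ (a - 1)) else 0

lemma PK_pos {a x : ℝ} (hx : 0 < x) : PK a x = ENNReal.ofReal (x ^ (a - 1)) := if_pos hx

lemma PK_nonpos {a x : ℝ} (hx : x ≤ 0) : PK a x = 0 := if_neg (not_lt.2 hx)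

lemma PK_one {x : ℝ} (hx : 0 < x) : PK 1 x = 1 := by simp [PK, hx]

@[fun_prop]
lemma PK_meas (a : ℝ) : Measurable (PK a) :=
  Measurable.ite measurableSet_Ioi (by fun_prop) (by fun_prop)

@[fun_prop]
lemma PK_meas' {α : Type*} [MeasurableSpace α] (a : ℝ) {f : α → ℝ} (hf : Measurable f) :
    Measurable (fun x => PK a (f x)) := (PK_meas a).comp hf

lemma PK_ne_top (a x : ℝ) : PK a x ≠ ⊤ := by
  unfold PK; split_ifs <;> simp

lemma PK_mul (a b x : ℝ) : PK a x * PK b x = PK (a + b - 1) x := by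
  rcases le_or_gt x 0 with hx | hx
  · simp [PK_nonpos hx]
  · rw [PK_pos hx, PK_pos hx, PK_pos hx, ← ENNReal.ofReal_mul (by positivity), ← rpow_add hx]
    congr 2; ring

lemma PK_scale (a : ℝ) {c : ℝ} (hc : 0 < c) (x : ℝ) : PK a (c * x) = PK a c * PK a x := by
  rcases le_or_gt x 0 with hx | hx
  · rw [PK_nonpos hx, PK_nonpos (by nlinarith), mul_zero]
  · rw [PK_pos hx, PK_pos hc, PK_pos (by positivity), ← ENNReal.ofReal_mul (by positivity),
      mul_rpow hc.le hx.le]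

lemma PK_anti {a x y : ℝ} (ha : a ≤ 1) (hx : 0 < x) (hxy : x ≤ y) : PK a y ≤ PK a x := by
  rw [PK_pos hx, PK_pos (hx.trans_le hxy)]
  exact ENNReal.ofReal_le_ofReal (rpow_le_rpow_of_nonpos hx hxy (by linarith))

lemma PK_one_le (x : ℝ) : PK 1 x ≤ 1 := by
  unfold PK; split_ifs <;> simp

lemma lint_scale (f : ℝ → ℝ≥0∞) (hf : Measurable f) {c : ℝ} (hc : 0 < c) :
    ∫⁻ x, f x = PK 2 c * ∫⁻ x, f (c * x) := by
  conv_lhs => rw [← Real.smul_map_volume_mul_left hc.ne']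
  rw [lintegral_smul_measure, lintegral_map hf (by fun_prop), PK_pos hc, abs_of_pos hc, smul_eq_mul]
  norm_num

lemma lint_beta {a b : ℝ} (ha : 0 < a) (hb : 0 < b) :
    ∫⁻ x, PK a x * PK b (1 - x) = ENNReal.ofReal (beta a b) := by
  have h := lintegral_betaPDF_eq_one ha hb
  have hB := beta_pos ha hb
  have h2 : ∀ x, PK a x * PK b (1 - x) = ENNReal.ofReal (beta a b) * betaPDF a b x := by
    intro x
    rcases le_or_gt x 0 with hx | hx
    · rw [betaPDF_eq_zero_of_nonpos hx, PK_nonpos hx]; simp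
    rcases le_or_gt 1 x with hx1 | hx1
    · rw [betaPDF_eq_zero_of_one_le hx1, PK_nonpos (a := b) (by linarith)]; simp
    have : 0 < 1 - x := by linarith
    rw [betaPDF_of_pos_lt_one hx hx1, PK_pos hx, PK_pos this, ← ENNReal.ofReal_mul (by positivity),
      ← ENNReal.ofReal_mul (by positivity)]
    congr 1; field_simp
  simp_rw [h2]
  rw [lintegral_const_mul' _ _ ENNReal.ofReal_ne_top, h, mul_one]

lemma lint_conv {a b : ℝ} (ha : 0 < a) (hb : 0 < b) (c : ℝ) :
    ∫⁻ x, PK a x * PK b (c - x) = ENNReal.ofReal (beta a b) * PK (a + b) c := by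
  rcases le_or_gt c 0 with hc | hc
  · rw [PK_nonpos hc, mul_zero]
    have : ∀ x, PK a x * PK b (c - x) = 0 := by
      intro x
      rcases le_or_gt x 0 with hx | hx
      · simp [PK_nonpos hx]
      · rw [PK_nonpos (a := b) (by linarith), mul_zero]
    simp [this]
  · rw [lint_scale _ (by fun_prop) hc]
    have : ∀ x, PK a (c * x) * PK b (c - c * x) = (PK a c * PK b c) * (PK a x * PK b (1 - x)) := by
      intro x
      rw [show c - c * x = c * (1 - x) by ring, PK_scale _ hc, PK_scale _ hc]; ring
    simp_rw [this]
    rw [lintegral_const_mul _ (by fun_prop), lint_beta ha hb, PK_mul, ← mul_assoc, PK_mul, mul_comm]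
    congr 2; ring

lemma rev2 (h : ℝ → ℝ → ℝ≥0∞) (hm : Measurable (fun p : ℝ × ℝ => h p.1 p.2)) :
    ∫⁻ x, ∫⁻ y, h x y = ∫⁻ y, ∫⁻ x, h x y :=
  lintegral_lintegral_swap hm.aemeasurable

/-- conversion of interval integrals -/
lemma conv_step (f : ℝ → ℝ) (F : ℝ → ℝ≥0∞) (a : ℝ) (ha : 0 ≤ a) (hF : Measurable F)
    (hf : ∀ y, 0 < y → y < a → f y = (F y).toReal) (h0 : ∀ y, y ≤ 0 → F y = 0)
    (h1 : ∀ y, a ≤ y → F y = 0) (hfin : ∀ y, 0 < y → y < a → F y ≠ ⊤) :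
    ∫ y in (0:ℝ)..a, f y = (∫⁻ y, F y).toReal := by
  have hfin' : ∀ y, F y < ⊤ := by
    intro y
    rcases le_or_gt y 0 with hy | hy
    · simp [h0 y hy]
    rcases le_or_gt a y with hy' | hy'
    · simp [h1 y hy']
    exact (hfin y hy hy').lt_top
  rw [intervalIntegral.integral_of_le ha, integral_Ioc_eq_integral_Ioo,
    setIntegral_congr_fun (g := fun y => (F y).toReal) measurableSet_Ioo (fun y hy => hf y hy.1 hy.2),
    integral_toReal hF.aemeasurable (Eventually.of_forall hfin'), setLIntegral_eq_of_support_subset]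
  intro y hy
  by_contra hc
  apply hy
  rcases le_or_gt y 0 with hy0 | hy0
  · exact h0 y hy0
  · exact h1 y (not_lt.1 fun h => hc ⟨hy0, h⟩)


noncomputable def H5 (d y1 y4 : ℝ) : ℝ≥0∞ :=
  ∫⁻ y5, PK 1 y5 * (PK (1 - d) (y1 - y5) * PK (1 - d) (y4 - y5))
noncomputable def H4 (d y1 y2 y3 : ℝ) : ℝ≥0∞ :=
  ∫⁻ y4, PK (1 - d) (y2 - y4) * PK 1 (y3 - y4) * H5 d y1 y4
noncomputable def H3 (d y1 y2 : ℝ) : ℝ≥0∞ :=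
  ∫⁻ y3, PK (1 - d) (y1 - y3) * PK (1 - d) (y2 - y3) * H4 d y1 y2 y3
noncomputable def H2 (d y1 : ℝ) : ℝ≥0∞ := ∫⁻ y2, PK 1 (y1 - y2) * H3 d y1 y2

@[fun_prop]
lemma H5_meas {α : Type*} [MeasurableSpace α] (d : ℝ) {f g : α → ℝ} (hf : Measurable f)
    (hg : Measurable g) : Measurable (fun x => H5 d (f x) (g x)) := by
  unfold H5; fun_prop
@[fun_prop]
lemma H4_meas {α : Type*} [MeasurableSpace α] (d : ℝ) {f g h : α → ℝ} (hf : Measurable f)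
    (hg : Measurable g) (hh : Measurable h) : Measurable (fun x => H4 d (f x) (g x) (h x)) := by
  unfold H4; fun_prop
@[fun_prop]
lemma H3_meas {α : Type*} [MeasurableSpace α] (d : ℝ) {f g : α → ℝ} (hf : Measurable f)
    (hg : Measurable g) : Measurable (fun x => H3 d (f x) (g x)) := by
  unfold H3; fun_prop
@[fun_prop]
lemma H2_meas {α : Type*} [MeasurableSpace α] (d : ℝ) {f : α → ℝ} (hf : Measurable f) :
    Measurable (fun x => H2 d (f x)) := by
  unfold H2; fun_prop

lemma H5_bd {d : ℝ} (h0 : 0 < d) (h1 : d < 1/2) : ∃ C : ℝ≥0∞, C ≠ ⊤ ∧ ∀ y1 y4, y4 ≤ y1 →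
    H5 d y1 y4 ≤ C * PK (2 - 2 * d) y4 := by
  refine ⟨ENNReal.ofReal (beta 1 (1 - 2 * d)), ENNReal.ofReal_ne_top, fun y1 y4 h => ?_⟩
  have := lint_conv (a := 1) (b := 1 - 2 * d) one_pos (by linarith) y4
  rw [show 2 - 2 * d = 1 + (1 - 2 * d) by ring, ← this]
  unfold H5
  refine lintegral_mono fun y5 => ?_
  gcongr
  rcases le_or_gt y4 y5 with hy | hy
  · rw [PK_nonpos (x := y4 - y5) (by linarith)]; simp
  · rw [show 1 - 2 * d = (1 - d) + (1 - d) - 1 by ring, ← PK_mul]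
    gcongr
    exact PK_anti (by linarith) (by linarith) (by linarith)

lemma H4_bd {d : ℝ} (h0 : 0 < d) (h1 : d < 1/2) : ∃ C : ℝ≥0∞, C ≠ ⊤ ∧ ∀ y1 y2 y3, y3 ≤ y2 →
    y2 ≤ y1 → H4 d y1 y2 y3 ≤ C * PK (3 - 3 * d) y3 := by
  obtain ⟨C, hC, hb⟩ := H5_bd h0 h1
  refine ⟨C * ENNReal.ofReal (beta (2 - 2 * d) (1 - d)), ENNReal.mul_ne_top hC ENNReal.ofReal_ne_top,
    fun y1 y2 y3 h h' => ?_⟩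
  have := lint_conv (a := 2 - 2 * d) (b := 1 - d) (by linarith) (by linarith) y3
  rw [show 3 - 3 * d = 2 - 2 * d + (1 - d) by ring, mul_assoc, ← this, ← lintegral_const_mul' _ _ hC]
  unfold H4
  refine lintegral_mono fun y4 => ?_
  rcases le_or_gt y3 y4 with hy | hy
  · rw [PK_nonpos (x := y3 - y4) (by linarith)]; simp
  · calc _ ≤ PK (1 - d) (y3 - y4) * 1 * (C * PK (2 - 2 * d) y4) := by
          gcongr
          · exact PK_anti (by linarith) (by linarith) (by linarith)
          · exact PK_one_le _
          · exact hb _ _ (by linarith)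
      _ = _ := by ring

lemma H3_bd {d : ℝ} (h0 : 0 < d) (h1 : d < 1/2) : ∃ C : ℝ≥0∞, C ≠ ⊤ ∧ ∀ y1 y2, 
    y2 ≤ y1 → H3 d y1 y2 ≤ C * PK (4 - 5 * d) y2 := by
  obtain ⟨C, hC, hb⟩ := H4_bd h0 h1
  refine ⟨C * ENNReal.ofReal (beta (3 - 3 * d) (1 - 2 * d)),
    ENNReal.mul_ne_top hC ENNReal.ofReal_ne_top, fun y1 y2 h => ?_⟩
  have := lint_conv (a := 3 - 3 * d) (b := 1 - 2 * d) (by linarith) (by linarith) y2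
  rw [show 4 - 5 * d = 3 - 3 * d + (1 - 2 * d) by ring, mul_assoc, ← this,
    ← lintegral_const_mul' _ _ hC]
  unfold H3
  refine lintegral_mono fun y3 => ?_
  rcases le_or_gt y2 y3 with hy | hy
  · rw [PK_nonpos (x := y2 - y3) (by linarith)]; simp
  · calc _ ≤ PK (1 - d) (y2 - y3) * PK (1 - d) (y2 - y3) * (C * PK (3 - 3 * d) y3) := by
          gcongr
          · exact PK_anti (by linarith) (by linarith) (by linarith)
          · exact hb _ _ _ (by linarith) (by linarith)
      _ = _ := by
          rw [PK_mul, show 1 - d + (1 - d) - 1 = 1 - 2 * d by ring]; ring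

lemma H2_bd {d : ℝ} (h0 : 0 < d) (h1 : d < 1/2) : ∃ C : ℝ≥0∞, C ≠ ⊤ ∧ ∀ y1,
    H2 d y1 ≤ C * PK (5 - 5 * d) y1 := by
  obtain ⟨C, hC, hb⟩ := H3_bd h0 h1
  refine ⟨C * ENNReal.ofReal (beta (4 - 5 * d) 1),
    ENNReal.mul_ne_top hC ENNReal.ofReal_ne_top, fun y1 => ?_⟩
  have := lint_conv (a := 4 - 5 * d) (b := 1) (by linarith) (by linarith) y1
  rw [show 5 - 5 * d = 4 - 5 * d + 1 by ring, mul_assoc, ← this,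
    ← lintegral_const_mul' _ _ hC]
  unfold H2
  refine lintegral_mono fun y2 => ?_
  rcases le_or_gt y1 y2 with hy | hy
  · rw [PK_nonpos (x := y1 - y2) (by linarith)]; simp
  · calc _ ≤ PK 1 (y1 - y2) * (C * PK (4 - 5 * d) y2) := by
          gcongr
          exact hb _ _ hy.le
      _ = _ := by ring

lemma zero_of_bd {a x : ℝ} {F : ℝ≥0∞} {C : ℝ≥0∞} (h : F ≤ C * PK a x) (hx : x ≤ 0) : F = 0 := by
  rw [PK_nonpos hx, mul_zero] at h
  exact le_antisymm h bot_le

lemma ne_top_of_bd {a x : ℝ} {F : ℝ≥0∞} {C : ℝ≥0∞} (hC : C ≠ ⊤) (h : F ≤ C * PK a x) : F ≠ ⊤ :=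
  ne_top_of_le_ne_top (ENNReal.mul_ne_top hC (PK_ne_top _ _)) h

lemma PK_toReal {d x : ℝ} (hx : 0 < x) : (PK (1 - d) x).toReal = x ^ (-d) := by
  rw [PK_pos hx, ENNReal.toReal_ofReal (by positivity)]; congr 1; ring

lemma main_conv {d : ℝ} (h0 : 0 < d) (h1 : d < 1/2) :
    (∫ y1 in (0:ℝ)..1, ∫ y2 in (0:ℝ)..y1, ∫ y3 in (0:ℝ)..y2, ∫ y4 in (0:ℝ)..y3, ∫ y5 in (0:ℝ)..y4,
      (y1 - y3) ^ (-d) * (y2 - y3) ^ (-d) * (y2 - y4) ^ (-d) * (y1 - y5) ^ (-d) * (y4 - y5) ^ (-d)) =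
    (∫⁻ y1, H2 d y1 * PK 1 (1 - y1)).toReal := by
  obtain ⟨C5, hC5, b5⟩ := H5_bd h0 h1
  obtain ⟨C4, hC4, b4⟩ := H4_bd h0 h1
  obtain ⟨C3, hC3, b3⟩ := H3_bd h0 h1
  obtain ⟨C2, hC2, b2⟩ := H2_bd h0 h1
  refine conv_step _ _ _ zero_le_one (by fun_prop) ?_ ?_ ?_ ?_
  rotate_left
  · intro y hy; rw [zero_of_bd (b2 y) hy, zero_mul]
  · intro y hy; rw [PK_nonpos (by linarith), mul_zero]
  · intro y _ _; exact ENNReal.mul_ne_top (ne_top_of_bd hC2 (b2 y)) (PK_ne_top _ _)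
  intro y1 hy1 hy1'
  rw [PK_one (by linarith), mul_one]
  refine conv_step _ _ _ hy1.le (by fun_prop) ?_ ?_ ?_ ?_
  rotate_left
  · intro y hy; rw [zero_of_bd (b3 y1 y (by linarith)) hy, mul_zero]
  · intro y hy; rw [PK_nonpos (by linarith), zero_mul]
  · intro y _ h; exact ENNReal.mul_ne_top (PK_ne_top _ _) (ne_top_of_bd hC3 (b3 y1 y h.le)) 
  intro y2 hy2 hy2'
  rw [PK_one (by linarith), one_mul]
  refine conv_step _ _ _ hy2.le (by fun_prop) ?_ ?_ ?_ ?_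
  rotate_left
  · intro y hy; rw [zero_of_bd (b4 y1 y2 y (by linarith) (by linarith)) hy, mul_zero]
  · intro y hy; rw [PK_nonpos (x := y2 - y) (by linarith), mul_zero, zero_mul]
  · intro y _ h
    exact ENNReal.mul_ne_top (ENNReal.mul_ne_top (PK_ne_top _ _) (PK_ne_top _ _))
      (ne_top_of_bd hC4 (b4 y1 y2 y h.le hy2'.le)) 
  intro y3 hy3 hy3'
  unfold H4
  rw [← lintegral_const_mul _ (by fun_prop)]
  refine conv_step _ _ _ hy3.le (by fun_prop) ?_ ?_ ?_ ?_
  rotate_left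
  · intro y hy; rw [zero_of_bd (b5 y1 y (by linarith)) hy]; simp
  · intro y hy; rw [PK_nonpos (x := y3 - y) (by linarith)]; simp
  · intro y _ h
    exact ENNReal.mul_ne_top (ENNReal.mul_ne_top (PK_ne_top _ _) (PK_ne_top _ _))
      (ENNReal.mul_ne_top (ENNReal.mul_ne_top (PK_ne_top _ _) (PK_ne_top _ _))
      (ne_top_of_bd hC5 (b5 y1 y (by linarith))))
  intro y4 hy4 hy4'
  unfold H5
  rw [← lintegral_const_mul _ (by fun_prop), ← lintegral_const_mul _ (by fun_prop)]
  refine conv_step _ _ _ hy4.le (by fun_prop) ?_ ?_ ?_ ?_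
  rotate_left
  · intro y hy; rw [PK_nonpos (x := y) (by linarith)]; simp
  · intro y hy; rw [PK_nonpos (x := y4 - y) (by linarith)]; simp
  · intro y _ h
    refine ENNReal.mul_ne_top ?_ (ENNReal.mul_ne_top ?_ (ENNReal.mul_ne_top ?_ (ENNReal.mul_ne_top ?_ ?_))) <;>
    first
    | exact PK_ne_top _ _
    | exact ENNReal.mul_ne_top (PK_ne_top _ _) (PK_ne_top _ _)
  intro y5 hy5 hy5'
  simp only [ENNReal.toReal_mul]
  rw [PK_toReal (by linarith), PK_toReal (by linarith), PK_toReal (by linarith), PK_toReal (by linarith),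
    PK_toReal (by linarith), PK_one (by linarith), PK_one (by linarith)]
  simp; ring

lemma rev3 (f : ℝ × ℝ × ℝ → ℝ≥0∞) (hf : Measurable f) :
    ∫⁻ a, ∫⁻ b, ∫⁻ c, f (a, b, c) = ∫⁻ c, ∫⁻ b, ∫⁻ a, f (a, b, c) := by
  calc _ = ∫⁻ a, ∫⁻ c, ∫⁻ b, f (a, b, c) := by
        refine lintegral_congr fun a => rev2 _ (by fun_prop)
    _ = ∫⁻ c, ∫⁻ a, ∫⁻ b, f (a, b, c) := rev2 _ (by fun_prop)
    _ = _ := by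
        refine lintegral_congr fun c => rev2 _ (by fun_prop)

lemma rev4 (f : ℝ × ℝ × ℝ × ℝ → ℝ≥0∞) (hf : Measurable f) :
    ∫⁻ a, ∫⁻ b, ∫⁻ c, ∫⁻ e, f (a, b, c, e) = ∫⁻ e, ∫⁻ c, ∫⁻ b, ∫⁻ a, f (a, b, c, e) := by
  calc _ = ∫⁻ a, ∫⁻ e, ∫⁻ c, ∫⁻ b, f (a, b, c, e) := by
        refine lintegral_congr fun a => rev3 (fun p => f (a, p)) (by fun_prop)
    _ = ∫⁻ e, ∫⁻ a, ∫⁻ c, ∫⁻ b, f (a, b, c, e) := rev2 _ (by fun_prop)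
    _ = ∫⁻ e, ∫⁻ c, ∫⁻ a, ∫⁻ b, f (a, b, c, e) := by
        refine lintegral_congr fun c => rev2 _ (by fun_prop)
    _ = _ := by
        refine lintegral_congr fun e => lintegral_congr fun c => rev2 _ (by fun_prop)

noncomputable def AA (d c : ℝ) : ℝ≥0∞ :=
  ∫⁻ x3, ∫⁻ x2, PK (1 - d) x3 * PK 1 (c - x3) * (PK 1 x2 * PK (1 - d) (x3 - x2) * PK (1 - d) (c - x2))

noncomputable def QQ (d s : ℝ) : ℝ≥0∞ :=
  ∫⁻ b, ∫⁻ t, PK s b * PK 1 (1 - b) * (PK 1 t * PK (1 - d) (1 - t) * PK (1 - d) (1 - b * t))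

lemma H2_eq (d y1 : ℝ) :
    H2 d y1 = ∫⁻ x5, PK (1 - d) x5 * PK 1 (y1 - x5) * ∫⁻ x4, PK (1 - d) (x5 - x4) * AA d x4 := by
  calc H2 d y1 = ∫⁻ x2, ∫⁻ x3, ∫⁻ x4, ∫⁻ x5, (fun p : ℝ × ℝ × ℝ × ℝ =>
        PK (1 - d) p.2.2.2 * PK 1 (y1 - p.2.2.2) * (PK (1 - d) (p.2.2.2 - p.2.2.1) *
        (PK (1 - d) p.2.1 * PK 1 (p.2.2.1 - p.2.1) * (PK 1 p.1 * PK (1 - d) (p.2.1 - p.1)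
          * PK (1 - d) (p.2.2.1 - p.1))))) (x2, x3, x4, x5) := by
        unfold H2
        rw [← lintegral_sub_left_eq_self _ y1]
        refine lintegral_congr fun x2 => ?_
        unfold H3
        rw [← lintegral_sub_left_eq_self _ y1, ← lintegral_const_mul _ (by fun_prop)]
        refine lintegral_congr fun x3 => ?_
        unfold H4
        rw [← lintegral_sub_left_eq_self _ y1, ← lintegral_const_mul _ (by fun_prop),
          ← lintegral_const_mul _ (by fun_prop)]
        refine lintegral_congr fun x4 => ?_
        unfold H5
        rw [← lintegral_sub_left_eq_self _ y1, ← lintegral_const_mul _ (by fun_prop),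
          ← lintegral_const_mul _ (by fun_prop), ← lintegral_const_mul _ (by fun_prop)]
        refine lintegral_congr fun x5 => ?_
        simp only [sub_sub_cancel, sub_sub_sub_cancel_left]
        ring
    _ = _ := by
        refine (rev4 (fun p : ℝ × ℝ × ℝ × ℝ =>
        PK (1 - d) p.2.2.2 * PK 1 (y1 - p.2.2.2) * (PK (1 - d) (p.2.2.2 - p.2.2.1) *
        (PK (1 - d) p.2.1 * PK 1 (p.2.2.1 - p.2.1) * (PK 1 p.1 * PK (1 - d) (p.2.1 - p.1)
          * PK (1 - d) (p.2.2.1 - p.1))))) (by fun_prop)).trans ?_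
        refine lintegral_congr fun x5 => ?_
        rw [← lintegral_const_mul _ (by unfold AA; fun_prop)]
        refine lintegral_congr fun x4 => ?_
        unfold AA
        rw [← lintegral_const_mul _ (by fun_prop), ← lintegral_const_mul _ (by fun_prop)]
        refine lintegral_congr fun x3 => ?_
        rw [← lintegral_const_mul _ (by fun_prop), ← lintegral_const_mul _ (by fun_prop)]

lemma AA_eq (d c : ℝ) : AA d c = QQ d (2 - 2 * d) * PK (3 - 3 * d) c := by
  rcases le_or_gt c 0 with hc | hc
  · rw [PK_nonpos hc, mul_zero]
    unfold AA
    have : ∀ x3 x2, PK (1 - d) x3 * PK 1 (c - x3) * (PK 1 x2 * PK (1 - d) (x3 - x2) * PK (1 - d) (c - x2)) = 0 := by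
      intro x3 x2
      rcases le_or_gt x3 0 with hx | hx
      · simp [PK_nonpos hx]
      · rw [PK_nonpos (x := c - x3) (by linarith)]; simp
    simp [this]
  · unfold AA
    rw [lint_scale _ (by fun_prop) hc, mul_comm, mul_comm (QQ _ _)]
    unfold QQ
    rw [← lintegral_const_mul _ (by fun_prop), ← lintegral_mul_const _ (by fun_prop)]
    refine lintegral_congr fun b => ?_
    rcases le_or_gt b 0 with hb | hb
    · rw [PK_nonpos (a := 1 - d) (x := c * b) (by nlinarith), PK_nonpos (a := 2 - 2 * d) hb]; simp
    rw [lint_scale _ (by fun_prop) (mul_pos hc hb), ← lintegral_const_mul _ (by fun_prop),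
      ← lintegral_const_mul _ (by fun_prop), ← lintegral_mul_const _ (by fun_prop)]
    refine lintegral_congr fun t => ?_
    rw [show c - c * b = c * (1 - b) by ring, show c * b - c * b * t = c * (b * (1 - t)) by ring,
      show c - c * b * t = c * (1 - b * t) by ring, show c * b * t = c * (b * t) by ring]
    simp only [PK_scale _ hc, PK_scale _ hb, PK_one hc, PK_one hb]
    have e1 : PK (3 - 3 * d) c = PK 2 c * PK (1 - d) c * PK (1 - d) c * PK (1 - d) c * PK 2 c := by
      simp only [PK_mul]; congr 1; ring
    have e2 : PK (2 - 2 * d) b = PK 2 b * PK (1 - d) b * PK (1 - d) b := by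
      simp only [PK_mul]; congr 1; ring
    rw [e1, e2]
    ring

lemma total_eq {d : ℝ} (h0 : 0 < d) (h1 : d < 1/2) :
    ∫⁻ y1, H2 d y1 * PK 1 (1 - y1) = QQ d (2 - 2 * d) * ENNReal.ofReal (beta (3 - 3 * d) (1 - d)) *
      ENNReal.ofReal (beta (4 - 5 * d) 1) * ENNReal.ofReal (beta (5 - 5 * d) 1) := by
  have e1 : ∀ x5, ∫⁻ x4, PK (1 - d) (x5 - x4) * AA d x4 =
      QQ d (2 - 2 * d) * ENNReal.ofReal (beta (3 - 3 * d) (1 - d)) * PK (4 - 4 * d) x5 := by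
    intro x5
    rw [show 4 - 4 * d = 3 - 3 * d + (1 - d) by ring, mul_assoc, 
      ← lint_conv (by linarith) (by linarith), ← lintegral_const_mul _ (by fun_prop)]
    refine lintegral_congr fun x => ?_
    rw [AA_eq]; ring
  have e2 : ∀ y1, H2 d y1 = QQ d (2 - 2 * d) * ENNReal.ofReal (beta (3 - 3 * d) (1 - d)) *
      ENNReal.ofReal (beta (4 - 5 * d) 1) * PK (5 - 5 * d) y1 := by
    intro y1
    rw [show 5 - 5 * d = 4 - 5 * d + 1 by ring, mul_assoc,
      ← lint_conv (by linarith) (by linarith), ← lintegral_const_mul _ (by fun_prop), H2_eq]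
    refine lintegral_congr fun x => ?_
    rw [e1, show 4 - 5 * d = (1 - d) + (4 - 4 * d) - 1 by ring, ← PK_mul]; ring
  have e3 := lint_beta (a := 5 - 5 * d) (b := 1) (by linarith) (by linarith)
  rw [← e3, ← lintegral_const_mul _ (by fun_prop)]
  refine lintegral_congr fun x => ?_
  rw [e2]; ring

lemma QQ_refl {d s : ℝ} (hd : d < 1) (hs : 0 < s) (hs1 : s < 1) :
    QQ d s + QQ d (1 - s) = ENNReal.ofReal (beta s (1 - d) * beta (1 - s) (1 - d)) := by
  have key : ∀ s', QQ d s' = ∫⁻ y, ∫⁻ u, PK s' u * PK (1 - d) (1 - u) * (PK (1 - s') y * PK (1 - d) (1 - y))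
      * PK 1 (y - u) := by
    intro s'
    unfold QQ
    rw [rev2 _ (by fun_prop)]
    refine lintegral_congr fun y => ?_
    rcases le_or_gt y 0 with hy | hy
    · rw [PK_nonpos (a := 1) (x := y) hy, PK_nonpos (a := 1 - s') (x := y) hy]; simp
    conv_rhs => rw [lint_scale _ (by fun_prop) hy, ← lintegral_const_mul _ (by fun_prop)]
    refine lintegral_congr fun b => ?_
    rw [show y - y * b = y * (1 - b) by ring]
    simp only [PK_scale _ hy, PK_one hy, mul_comm b y]
    have e1 : PK 2 y * PK s' y * PK (1 - s') y = 1 := by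
      simp only [PK_mul]; convert PK_one hy using 2; ring
    calc _ = 1 * (PK s' b * PK 1 (1 - b) * PK (1 - d) (1 - y) * PK (1 - d) (1 - y * b)) := by ring
      _ = (PK 2 y * PK s' y * PK (1 - s') y) *
          (PK s' b * PK 1 (1 - b) * PK (1 - d) (1 - y) * PK (1 - d) (1 - y * b)) := by rw [e1]
      _ = _ := by ring
  have e2 : QQ d (1 - s) = ∫⁻ y, ∫⁻ u, PK s u * PK (1 - d) (1 - u) * (PK (1 - s) y * PK (1 - d) (1 - y))
      * PK 1 (u - y) := by
    rw [key, rev2 _ (by fun_prop)]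
    refine lintegral_congr fun y => lintegral_congr fun u => ?_
    rw [sub_sub_cancel]; ring
  rw [e2, key s, ← lintegral_add_left (by fun_prop), ENNReal.ofReal_mul (beta_pos hs (by linarith)).le,
    ← lint_beta hs (by linarith), ← lint_beta (by linarith) (by linarith),
    ← lintegral_const_mul _ (by fun_prop)]
  refine lintegral_congr fun y => ?_
  rw [← lintegral_add_left (by fun_prop), ← lintegral_mul_const _ (by fun_prop)]
  refine lintegral_congr_ae ?_
  have : ∀ᵐ u : ℝ, u ≠ y := by simp [ae_iff]
  filter_upwards [this] with u hu
  have : PK 1 (y - u) + PK 1 (u - y) = 1 := by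
    rcases lt_or_gt_of_ne hu with h | h
    · rw [PK_one (by linarith), PK_nonpos (by linarith), add_zero]
    · rw [PK_one (x := u - y) (by linarith), PK_nonpos (by linarith), zero_add]
  rw [← mul_add, this, mul_one]

lemma poch_succ (a : ℝ) (k : ℕ) : poch a (k + 1) = poch a k * (a + k) := by
  simp [poch, Finset.prod_range_succ]

lemma poch_zero (a : ℝ) : poch a 0 = 1 := by simp [poch]

lemma poch_pos {a : ℝ} (ha : 0 < a) (k : ℕ) : 0 < poch a k :=
  Finset.prod_pos fun i _ => by positivity

lemma poch_one (k : ℕ) : poch 1 k = k.factorial := by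
  induction k with
  | zero => simp [poch]
  | succ k ih => rw [poch_succ, ih, Nat.factorial_succ]; push_cast; ring

lemma Gamma_poch {a : ℝ} (ha : 0 < a) (k : ℕ) : Real.Gamma (a + k) = poch a k * Real.Gamma a := by
  induction k with
  | zero => simp [poch]
  | succ k ih =>
    rw [poch_succ, Nat.cast_succ, ← add_assoc, Real.Gamma_add_one (by positivity), ih]; ring

lemma choose_poch (d : ℝ) (k : ℕ) : Ring.choose (d + k - 1) k = poch d k / k.factorial := by
  have h := Ring.factorial_nsmul_multichoose_eq_ascPochhammer d k
  rw [Polynomial.ascPochhammer_smeval_eq_eval] at h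
  have h2 : Polynomial.eval d (ascPochhammer ℝ k) = poch d k := by
    induction k with
    | zero => simp [poch]
    | succ k ih =>
      rw [ascPochhammer_succ_eval, poch_succ, ih]
      rw [Ring.factorial_nsmul_multichoose_eq_ascPochhammer, Polynomial.ascPochhammer_smeval_eq_eval]
  rw [h2, nsmul_eq_mul] at h
  rw [Ring.choose, eq_div_iff (by positivity), ← h, show d + k - 1 - k + 1 = d by ring]; ring

lemma binom_sum (d : ℝ) {x : ℝ} (hx : 0 ≤ x) (hx1 : x < 1) :
    HasSum (fun k : ℕ => poch d k / k.factorial * x ^ k) ((1 - x) ^ (-d)) := by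
  have h := (Real.one_div_one_sub_rpow_hasFPowerSeriesOnBall_zero d).hasSum (y := x)
    (by simp [Metric.mem_eball, edist_dist, abs_of_nonneg hx, hx1])
  have e1 : ∀ k : ℕ, (FormalMultilinearSeries.ofScalars ℝ (fun n : ℕ => Ring.choose (d + n - 1) n) k)
      (fun _ => x) = poch d k / k.factorial * x ^ k := by
    intro k
    simp [choose_poch, mul_comm]
  simp only [e1] at h
  rw [zero_add] at h
  rw [rpow_neg (by linarith), ← one_div]
  exact h

noncomputable def cc (d : ℝ) (k : ℕ) : ℝ := poch d k / poch (2 - d) k / (1 - d)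

lemma beta_one {a : ℝ} (ha : 0 < a) : beta a 1 = 1 / a := by
  have := Real.Gamma_pos_of_pos ha
  rw [beta, Real.Gamma_add_one ha.ne', Real.Gamma_one]; field_simp

lemma beta_nat {d : ℝ} (hd : d < 1) (k : ℕ) :
    beta (k + 1) (1 - d) = k.factorial / ((1 - d) * poch (2 - d) k) := by
  have h1 : 0 < 1 - d := by linarith
  have := Real.Gamma_pos_of_pos h1
  have := poch_pos (a := 2 - d) (by linarith) k
  have e : Real.Gamma (2 - d) = (1 - d) * Real.Gamma (1 - d) := by
    rw [← Real.Gamma_add_one h1.ne']; congr 1; ring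
  rw [beta, Real.Gamma_nat_eq_factorial, show (k:ℝ) + 1 + (1 - d) = (2 - d) + k by ring,
    Gamma_poch (by linarith), e]
  field_simp

lemma PK_pow (a x : ℝ) (k : ℕ) : PK a x * ENNReal.ofReal (x ^ k) = PK (a + k) x := by
  rcases le_or_gt x 0 with hx | hx
  · simp [PK_nonpos hx]
  · rw [PK_pos hx, PK_pos hx, ← ENNReal.ofReal_mul (by positivity), ← rpow_natCast, ← rpow_add hx]
    congr 2; ring

lemma QQ_series {d s : ℝ} (h0 : 0 < d) (hd : d < 1) (hs : 0 < s) :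
    QQ d s = ∑' k : ℕ, ENNReal.ofReal (cc d k / (k + s)) := by
  have key : ∀ b t, PK s b * PK 1 (1 - b) * (PK 1 t * PK (1 - d) (1 - t) * PK (1 - d) (1 - b * t)) =
      ∑' k : ℕ, ENNReal.ofReal (poch d k / k.factorial) * (PK (s + k) b * PK 1 (1 - b)) *
        (PK (k + 1) t * PK (1 - d) (1 - t)) := by
    intro b t
    rcases le_or_gt b 0 with hb | hb
    · simp [PK_nonpos hb]
    rcases le_or_gt 1 b with hb1 | hb1
    · simp [PK_nonpos (x := 1 - b) (by linarith)]
    rcases le_or_gt t 0 with ht | ht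
    · simp [PK_nonpos ht]
    rcases le_or_gt 1 t with ht1 | ht1
    · simp [PK_nonpos (x := 1 - t) (by linarith)]
    have hbt : 0 ≤ b * t := by positivity
    have hbt1 : b * t < 1 := by nlinarith
    have hp : ∀ k, 0 < poch d k := poch_pos h0
    have e := binom_sum d hbt hbt1
    have e1 : PK (1 - d) (1 - b * t) = ∑' k : ℕ, ENNReal.ofReal (poch d k / k.factorial * (b * t) ^ k) := by
      rw [← ENNReal.ofReal_tsum_of_nonneg _ e.summable, e.tsum_eq, PK_pos (by linarith)]
      · congr 2; ring
      · intro k; have := hp k; positivity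
    rw [e1, ← ENNReal.tsum_mul_left, ← ENNReal.tsum_mul_left]
    refine tsum_congr fun k => ?_
    have := hp k
    rw [mul_pow, ENNReal.ofReal_mul (by positivity), ENNReal.ofReal_mul (by positivity),
      ← PK_pow s, add_comm (k:ℝ) 1, ← PK_pow 1 t]
    ring
  unfold QQ
  simp_rw [key]
  calc _ = ∫⁻ b, ∑' k : ℕ, ∫⁻ t, ENNReal.ofReal (poch d k / k.factorial) * (PK (s + k) b * PK 1 (1 - b)) *
        (PK (k + 1) t * PK (1 - d) (1 - t)) := by
        refine lintegral_congr fun b => lintegral_tsum fun k => by fun_prop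
    _ = ∑' k : ℕ, ∫⁻ b, ∫⁻ t, ENNReal.ofReal (poch d k / k.factorial) * (PK (s + k) b * PK 1 (1 - b)) *
        (PK (k + 1) t * PK (1 - d) (1 - t)) := lintegral_tsum fun k => by fun_prop
    _ = _ := by
      refine tsum_congr fun k => ?_
      have hp := poch_pos h0 k
      have hp2 := poch_pos (a := 2 - d) (by linarith) k
      have h1d : 0 < 1 - d := by linarith
      have e : ∀ b, ∫⁻ t, ENNReal.ofReal (poch d k / k.factorial) * (PK (s + k) b * PK 1 (1 - b)) *
        (PK (k + 1) t * PK (1 - d) (1 - t)) = ENNReal.ofReal (poch d k / k.factorial) *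
          ENNReal.ofReal (beta (k + 1) (1 - d)) * (PK (s + k) b * PK 1 (1 - b)) := by
        intro b
        rw [lintegral_const_mul _ (by fun_prop), lint_beta (by positivity) (by linarith)]; ring
      simp_rw [e]
      rw [lintegral_const_mul _ (by fun_prop), lint_beta (by positivity) one_pos, beta_one (by positivity),
        beta_nat hd, ← ENNReal.ofReal_mul (by positivity), ← ENNReal.ofReal_mul (by positivity), cc]
      congr 1
      field_simp
      ring

lemma cc_pos {d : ℝ} (h0 : 0 < d) (hd : d < 1) (k : ℕ) : 0 < cc d k := by
  have hp := poch_pos h0 k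
  have hp2 := poch_pos (a := 2 - d) (by linarith) k
  have h1d : 0 < 1 - d := by linarith
  unfold cc; positivity

lemma cc_succ {d : ℝ} (hd : d < 1) (k : ℕ) : cc d (k + 1) * (k + 2 - d) = (k + d) * cc d k := by
  have hp2 := poch_pos (a := 2 - d) (by linarith) k
  have h1d : 0 < 1 - d := by linarith
  have : 0 < 2 - d + k := by have : (0:ℝ) ≤ k := by positivity
                             linarith
  unfold cc
  rw [poch_succ, poch_succ]
  field_simp
  ring

lemma cc_le {d : ℝ} (h0 : 0 < d) (h1 : d < 1/2) (k : ℕ) : (k + 1 - d) * cc d k ≤ 1 := by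
  induction k with
  | zero =>
    have h1d : 0 < 1 - d := by linarith
    simp [cc, poch]; field_simp; exact le_refl _
  | succ k ih =>
    have := cc_succ (d := d) (by linarith) k
    have := cc_pos h0 (by linarith) k
    push_cast
    nlinarith

lemma cc_anti {d : ℝ} (h0 : 0 < d) (h1 : d < 1/2) (k : ℕ) : cc d (k + 1) ≤ cc d k := by
  have := cc_succ (d := d) (by linarith) k
  have := cc_pos h0 (by linarith) k
  have := cc_pos h0 (by linarith) (k + 1)
  have : (0:ℝ) ≤ k := by positivity
  by_contra hc
  push Not at hc
  nlinarith

lemma cc_tendsto {d : ℝ} (h0 : 0 < d) (h1 : d < 1/2) : Tendsto (cc d) atTop (𝓝 0) := by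
  have : Tendsto (fun k : ℕ => 1 / ((k:ℝ) + (1 - d))) atTop (𝓝 0) := by
    refine tendsto_const_nhds.div_atTop ?_
    exact tendsto_atTop_add_const_right _ _ tendsto_natCast_atTop_atTop
  refine squeeze_zero (fun k => (cc_pos h0 (by linarith) k).le) (fun k => ?_) this
  have hk : 0 < (k:ℝ) + (1 - d) := by
    have : (0:ℝ) ≤ k := by positivity
    linarith
  rw [le_div_iff₀ hk]
  have := cc_le h0 h1 k
  linarith

lemma cc_summable {d s : ℝ} (h0 : 0 < d) (h1 : d < 1/2) (hs : 0 < s) :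
    Summable (fun k : ℕ => cc d k / (k + s)) := by
  have main : ∀ s, 0 < s → s < 1 → Summable (fun k : ℕ => cc d k / (k + s)) := by
    intro s hs hs1
    have e := QQ_refl (d := d) (by linarith) hs hs1
    have hne : ∑' k : ℕ, ENNReal.ofReal (cc d k / (k + s)) ≠ ⊤ := by
      rw [← QQ_series h0 (by linarith) hs]
      refine ne_top_of_le_ne_top ?_ (le_self_add (a := QQ d s) (b := QQ d (1 - s)))
      rw [e]; exact ENNReal.ofReal_ne_top
    refine (ENNReal.summable_toReal hne).congr fun k => ?_
    have := cc_pos h0 (by linarith) k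
    rw [ENNReal.toReal_ofReal (by positivity)]
  rcases lt_or_ge s 1 with h | h
  · exact main s hs h
  · refine Summable.of_nonneg_of_le (fun k => ?_) (fun k => ?_) (main (1/2) (by norm_num) (by norm_num))
    · have := cc_pos h0 (by linarith) k
      positivity
    · have := cc_pos h0 (by linarith) k
      gcongr; linarith

lemma cc_summable' {d s : ℝ} (h0 : 0 < d) (h1 : d < 1/2) (hs : 0 < s) :
    Summable (fun k : ℕ => cc d (k + 1) / (k + s)) := by
  refine Summable.of_nonneg_of_le (fun k => ?_) (fun k => ?_) (cc_summable h0 h1 hs)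
  · have := cc_pos h0 (by linarith) (k + 1)
    positivity
  · have := cc_anti h0 h1 k
    gcongr

lemma QQ_eq {d s : ℝ} (h0 : 0 < d) (h1 : d < 1/2) (hs : 0 < s) :
    QQ d s = ENNReal.ofReal (∑' k : ℕ, cc d k / (k + s)) := by
  rw [QQ_series h0 (by linarith) hs, ENNReal.ofReal_tsum_of_nonneg _ (cc_summable h0 h1 hs)]
  intro k
  have := cc_pos h0 (by linarith) k
  positivity

lemma cc_rec {d s : ℝ} (h0 : 0 < d) (h1 : d < 1/2) (hs : 0 < s) :
    (d - s) * (∑' k : ℕ, cc d k / (k + s)) + cc d 0 =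
      (2 - d - s) * ∑' k : ℕ, cc d (k + 1) / (k + s) := by
  have a := (cc_summable h0 h1 hs).hasSum.mul_left (d - s)
  have b := (cc_summable' h0 h1 hs).hasSum.mul_left (2 - d - s)
  have c := (b.sub a).tendsto_sum_nat
  have e : ∀ N : ℕ, ∑ k ∈ Finset.range N, ((2 - d - s) * (cc d (k + 1) / (k + s)) -
      (d - s) * (cc d k / (k + s))) = cc d 0 - cc d N := by
    intro N
    rw [← Finset.sum_range_sub']
    refine Finset.sum_congr rfl fun k _ => ?_
    have := cc_succ (d := d) (by linarith) k
    have hk : 0 < (k:ℝ) + s := by positivity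
    field_simp
    linarith
  simp_rw [e] at c
  have f := (tendsto_const_nhds (x := cc d 0)).sub (cc_tendsto h0 h1)
  have := tendsto_nhds_unique c f
  linarith

lemma cc_shift {d s : ℝ} (h0 : 0 < d) (h1 : d < 1/2) (hs : 0 < s) :
    ∑' k : ℕ, cc d k / (k + (s - 1)) = cc d 0 / (s - 1) + ∑' k : ℕ, cc d (k + 1) / (k + s) := by
  have e : ∀ k : ℕ, cc d (k + 1) / (((k + 1 : ℕ) : ℝ) + (s - 1)) = cc d (k + 1) / (k + s) := by
    intro k; push_cast; congr 1; ring
  have hsum : Summable (fun k : ℕ => cc d k / (k + (s - 1))) := by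
    rw [← summable_nat_add_iff 1]
    simp_rw [e]
    exact cc_summable' h0 h1 hs
  rw [hsum.tsum_eq_zero_add]
  simp_rw [e]
  simp

lemma F32_eq {d : ℝ} (h0 : 0 < d) (h1 : d < 1/2) :
    F32 1 d (2*d-1) (2-d) (2*d) = (2 * d - 1) * (1 - d) * ∑' k : ℕ, cc d k / (k + (2 * d - 1)) := by
  rw [F32, ← tsum_mul_left]
  refine tsum_congr fun k => ?_
  have h : ∀ k : ℕ, (k + (2 * d - 1)) ≠ 0 := by
    intro k
    rcases k with _ | k
    · push_cast; intro h; linarith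
    · push_cast; have : (0:ℝ) ≤ k := by positivity
      intro h; linarith
  have h2 : poch (2 * d - 1) k * (k + (2 * d - 1)) = (2 * d - 1) * poch (2 * d) k := by
    induction k with
    | zero => simp [poch]
    | succ k ih =>
      rw [poch_succ, poch_succ]; push_cast
      linear_combination (2 * d + k) * ih
  have hp2 := poch_pos (a := 2 - d) (by linarith) k
  have hp3 := poch_pos (a := 2 * d) (by linarith) k
  have h1d : 0 < 1 - d := by linarith
  have hk := h k
  rw [poch_one, cc]
  field_simp
  linear_combination poch d k * h2

theorem stmt17 (d : ℝ) (h0 : 0 < d) (h1 : d < 1/2) :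
    (∫ y1 in (0:ℝ)..1, ∫ y2 in (0:ℝ)..y1, ∫ y3 in (0:ℝ)..y2, ∫ y4 in (0:ℝ)..y3, ∫ y5 in (0:ℝ)..y4,
      (y1 - y3) ^ (-d) * (y2 - y3) ^ (-d) * (y2 - y4) ^ (-d) * (y1 - y5) ^ (-d) * (y4 - y5) ^ (-d)) =
    Gamma (1-d) ^ 3 * (Gamma (4-5*d) / (Gamma (4-4*d) * Gamma (6-5*d))) *
      (Gamma (2-2*d) * Gamma (2*d-1) / Gamma d) -
      Gamma (1-d) / (1-d) * (Gamma (2*d-1) / Gamma (2*d)) *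
      (Gamma (3-3*d) * Gamma (4-5*d) / (Gamma (4-4*d) * Gamma (6-5*d))) *
      F32 1 d (2*d-1) (2-d) (2*d) := by
  have tn : ∀ s, 0 < s → 0 ≤ ∑' k : ℕ, cc d k / (k + s) := fun s hs =>
    tsum_nonneg fun k => by have := cc_pos h0 (by linarith) k; positivity
  have r1 := cc_rec h0 h1 (s := 2 - 2 * d) (by linarith)
  have r2 := cc_rec h0 h1 (s := 2 * d) (by linarith)
  have t1 := cc_shift h0 h1 (s := 2 - 2 * d) (by linarith)
  have t2 := cc_shift h0 h1 (s := 2 * d) (by linarith)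
  have q := QQ_refl (d := d) (s := 2 * d) (by linarith) (by linarith) (by linarith)
  rw [QQ_eq h0 h1 (by linarith), QQ_eq h0 h1 (by linarith),
    ← ENNReal.ofReal_add (tn _ (by linarith)) (tn _ (by linarith)),
    ENNReal.ofReal_eq_ofReal_iff (add_nonneg (tn _ (by linarith)) (tn _ (by linarith)))
    (mul_pos (beta_pos (by linarith) (by linarith)) (beta_pos (by linarith) (by linarith))).le] at q
  rw [main_conv h0 h1, total_eq h0 h1, QQ_eq h0 h1 (by linarith), F32_eq h0 h1]
  simp only [ENNReal.toReal_mul]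
  rw [ENNReal.toReal_ofReal (tn _ (by linarith)),
    ENNReal.toReal_ofReal (beta_pos (by linarith) (by linarith)).le,
    ENNReal.toReal_ofReal (beta_pos (by linarith) (by linarith)).le,
    ENNReal.toReal_ofReal (beta_pos (by linarith) (by linarith)).le, beta_one (by linarith),
    beta_one (by linarith)]
  rw [show 2 - 2 * d - 1 = 1 - 2 * d by ring] at t1
  generalize ∑' k : ℕ, cc d k / (k + (2 - 2 * d)) = X at *
  generalize ∑' k : ℕ, cc d k / (k + (2 * d - 1)) = Y at *
  generalize ∑' k : ℕ, cc d k / (k + (1 - 2 * d)) = Z at *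
  generalize ∑' k : ℕ, cc d k / (k + 2 * d) = W at *
  generalize ∑' k : ℕ, cc d (k + 1) / (k + (2 - 2 * d)) = U at *
  generalize ∑' k : ℕ, cc d (k + 1) / (k + 2 * d) = V at *
  have c0 : cc d 0 = 1 / (1 - d) := by simp [cc, poch]
  rw [c0] at r1 r2 t1 t2
  have n1 : 1 - d ≠ 0 := by intro h; linarith
  have n2 : 1 - 2 * d ≠ 0 := by intro h; linarith
  have n3 : 2 - 3 * d ≠ 0 := by intro h; linarith
  have n4 : 4 - 5 * d ≠ 0 := by intro h; linarith
  have n5 : 5 - 5 * d ≠ 0 := by intro h; linarith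
  have n6 : 2 * d - 1 ≠ 0 := by intro h; linarith
  have key : (2 - 3 * d) * (X + Y) = - d * (W + Z) := by
    have u1 : U = Z - 1 / (1 - d) / (1 - 2 * d) := by linarith
    have u2 : V = Y + 1 / (1 - d) / (1 - 2 * d) := by
      rw [show 2 * d - 1 = -(1 - 2 * d) by ring, div_neg] at t2; linarith
    rw [u1] at r1; rw [u2] at r2
    have w : 1 / (1 - d) = (1 - 2 * d) * (1 / (1 - d) / (1 - 2 * d)) := by rw [mul_div_cancel₀ _ n2]
    generalize 1 / (1 - d) / (1 - 2 * d) = T at *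
    rw [w] at r1 r2
    linear_combination -r1 - r2
  have g1 : Gamma (6 - 5 * d) = (5 - 5 * d) * ((4 - 5 * d) * Gamma (4 - 5 * d)) := by
    rw [← Gamma_add_one n4, show 4 - 5 * d + 1 = 5 - 5 * d by ring, ← Gamma_add_one n5]; congr 1; ring
  have g2 : Gamma (2 * d) = (2 * d - 1) * Gamma (2 * d - 1) := by
    rw [← Gamma_add_one n6]; congr 1; ring
  have g3 : Gamma (2 - 2 * d) = (1 - 2 * d) * Gamma (1 - 2 * d) := by
    rw [← Gamma_add_one n2]; congr 1; ring
  have g4 : Gamma (3 - 3 * d) = (2 - 3 * d) * Gamma (2 - 3 * d) := by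
    rw [← Gamma_add_one n3]; congr 1; ring
  have p1 : Gamma (4 - 5 * d) ≠ 0 := (Gamma_pos_of_pos (by linarith)).ne'
  have p2 : Gamma (2 * d) ≠ 0 := (Gamma_pos_of_pos (by linarith)).ne'
  have p3 : Gamma (2 * d - 1) ≠ 0 := by intro h; rw [h, mul_zero] at g2; exact p2 g2
  have p4 : Gamma (1 - 2 * d) ≠ 0 := (Gamma_pos_of_pos (by linarith)).ne'
  have p5 : Gamma (2 - 3 * d) ≠ 0 := (Gamma_pos_of_pos (by linarith)).ne'
  have p6 : Gamma d ≠ 0 := (Gamma_pos_of_pos (by linarith)).ne'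
  have p7 : Gamma (4 - 4 * d) ≠ 0 := (Gamma_pos_of_pos (by linarith)).ne'
  have p8 : Gamma (1 - d) ≠ 0 := (Gamma_pos_of_pos (by linarith)).ne'
  have hX : X = -d * (beta (2 * d) (1 - d) * beta (1 - 2 * d) (1 - d)) / (2 - 3 * d) - Y := by
    rw [← q, ← key, mul_div_cancel_left₀ _ n3]; ring
  rw [hX]
  unfold beta
  rw [show 2 * d + (1 - d) = d + 1 by ring, Gamma_add_one h0.ne', show 1 - 2 * d + (1 - d) = 2 - 3 * d by ring,
    show 3 - 3 * d + (1 - d) = 4 - 4 * d by ring, g1, g2, g3, g4]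
  clear hX key t1 t2 r1 r2 q c0 tn g1 g2 g3 g4 p2
  have m6 : 2 * d - 1 = -(1 - 2 * d) := by ring
  generalize Gamma (4 - 5 * d) = G1 at *
  generalize Gamma (2 * d - 1) = G3 at *
  generalize Gamma (1 - 2 * d) = G4 at *
  generalize Gamma (2 - 3 * d) = G5 at *
  generalize Gamma (4 - 4 * d) = G7 at *
  generalize Gamma (1 - d) = G8 at *
  generalize Gamma d = G6 at *
  rw [m6]
  clear m6 n6
  generalize 1 - d = a1 at *
  generalize 1 - 2 * d = a2 at *
  generalize 2 - 3 * d = a3 at *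
  generalize 4 - 5 * d = a4 at *
  generalize 5 - 5 * d = a5 at *
  have hd := h0.ne'
  field_simp
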